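/- arXiv:1007.5508 — 3 statements merged into one kernel-verified Lean document; each statement's English description precedes it below -/
import Mathlib

section
/- Let a, b, c, d be integers with ad − bc = ±1, and let g_0, …, g_n ∈ ℤ be the coefficients of the transformed form f^g(x, y) := f(ax + by, cx + dy) = g_0x^n + g_1x^{n−1}y + ⋯ + g_ny^n (so g_0 = f(a, c)). Assume g_0 ≠ 0. Then there is a ring isomorphism R_f ≅ R_{f^g}, where R_{f^g} is constructed from the coefficients g_0, …, g_n exactly as R_f is constructed from f_0, …, f_n. -/
open Polynomial

noncomputable section

/-- The polynomial `f₀ Tⁿ + f₁ Tⁿ⁻¹ + ⋯ + fₙ` over `ℚ`. -/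
def fpoly (n : ℕ) (f : ℕ → ℤ) : Polynomial ℚ :=
  ∑ i ∈ Finset.range (n + 1), Polynomial.C (f i : ℚ) * Polynomial.X ^ (n - i)

/-- `Q_f = ℚ[T]/(f₀ Tⁿ + ⋯ + fₙ)`. -/
abbrev Qf (n : ℕ) (f : ℕ → ℤ) := AdjoinRoot (fpoly n f)

/-- `θ`, the image of `T` in `Q_f`. -/
def th (n : ℕ) (f : ℕ → ℤ) : Qf n f := AdjoinRoot.root _

/-- `ζ₀ = 1`, and `ζ_k = f₀ θ^k + f₁ θ^(k-1) + ⋯ + f_(k-1) θ` for `k ≥ 1`. -/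
def zeta (n : ℕ) (f : ℕ → ℤ) (k : ℕ) : Qf n f :=
  if k = 0 then 1 else ∑ i ∈ Finset.range k, (f i : Qf n f) * th n f ^ (k - i)

/-- `R_f`, the ℤ-span of `ζ₀, …, ζ_(n-1)` in `Q_f`. -/
def Rf (n : ℕ) (f : ℕ → ℤ) : Submodule ℤ (Qf n f) :=
  Submodule.span ℤ (Set.range fun k : Fin n => zeta n f k)

/-- The binary `n`-ic form `f₀ xⁿ + f₁ xⁿ⁻¹ y + ⋯ + f_n yⁿ` as a polynomial in
two variables `x = X 0`, `y = X 1`. -/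
def binForm (n : ℕ) (f : ℕ → ℤ) : MvPolynomial (Fin 2) ℤ :=
  ∑ i ∈ Finset.range (n + 1),
    MvPolynomial.C (f i) * MvPolynomial.X 0 ^ (n - i) * MvPolynomial.X 1 ^ i

/-- The partial Horner values `f₀ θ^k + f₁ θ^(k-1) + ⋯ + f_k`. -/
def horner {A : Type*} [CommRing A] (f : ℕ → ℤ) (θ : A) (k : ℕ) : A :=
  ∑ i ∈ Finset.range (k + 1), (f i : A) * θ ^ (k - i)

/-- The value at `(x, y)` of the form `f₀ xⁿ + f₁ xⁿ⁻¹ y + ⋯ + f_n yⁿ`. -/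
def formEval {A : Type*} [CommRing A] (n : ℕ) (f : ℕ → ℤ) (x y : A) : A :=
  ∑ i ∈ Finset.range (n + 1), (f i : A) * x ^ (n - i) * y ^ i

/-- The form with coefficients `g` is the form with coefficients `f` after the substitution
`(x, y) ↦ (ax + by, cx + dy)`, as functions on every commutative ring. -/
def IsTransform (n : ℕ) (f g : ℕ → ℤ) (a b c d : ℤ) : Prop :=
  ∀ (A : Type) [CommRing A] (x y : A),
    formEval n g x y = formEval n f (a * x + b * y) (c * x + d * y)

lemma horner_succ {A : Type*} [CommRing A] (f : ℕ → ℤ) (θ : A) (k : ℕ) :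
    horner f θ (k + 1) = θ * horner f θ k + f (k + 1) := by
  unfold horner
  rw [Finset.sum_range_succ, Finset.mul_sum]
  congr 1
  · refine Finset.sum_congr rfl fun i hi => ?_
    have : k + 1 - i = (k - i) + 1 := by have := Finset.mem_range.1 hi; omega
    rw [this]; ring
  · simp

lemma formEval_succ {A : Type*} [CommRing A] (n : ℕ) (f : ℕ → ℤ) (x y : A) :
    formEval (n + 1) f x y = x * formEval n f x y + f (n + 1) * y ^ (n + 1) := by
  unfold formEval
  rw [Finset.sum_range_succ, Finset.mul_sum]
  congr 1
  · refine Finset.sum_congr rfl fun i hi => ?_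
    have : n + 1 - i = (n - i) + 1 := by have := Finset.mem_range.1 hi; omega
    rw [this]; ring
  · simp

/-- Division of a binary form by `x - θ y`, with remainder. -/
lemma formEval_eq {A : Type*} [CommRing A] (n : ℕ) (f : ℕ → ℤ) (θ x y : A) :
    formEval n f x y = horner f θ n * y ^ n +
      (x - θ * y) * ∑ k ∈ Finset.range n, horner f θ k * x ^ (n - 1 - k) * y ^ k := by
  induction n with
  | zero => simp [formEval, horner]
  | succ n ih =>
    rw [formEval_succ, ih, horner_succ, Finset.sum_range_succ]
    have : ∑ k ∈ Finset.range n, horner f θ k * x ^ (n + 1 - 1 - k) * y ^ k =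
        x * ∑ k ∈ Finset.range n, horner f θ k * x ^ (n - 1 - k) * y ^ k := by
      rw [Finset.mul_sum]
      refine Finset.sum_congr rfl fun i hi => ?_
      have : n + 1 - 1 - i = (n - 1 - i) + 1 := by have := Finset.mem_range.1 hi; omega
      rw [this]; ring
    rw [this]
    simp only [Nat.add_sub_cancel, Nat.sub_self, pow_zero]
    ring

lemma formEval_one_zero {A : Type*} [CommRing A] (n : ℕ) (f : ℕ → ℤ) :
    formEval n f (1 : A) 0 = f 0 := by
  simp [formEval, Finset.sum_range_succ']

lemma formEval_one_right {A : Type*} [CommRing A] (n : ℕ) (f : ℕ → ℤ) (x : A) :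
    formEval n f x 1 = horner f x n := by
  simp [formEval, horner]

lemma map_horner {A B : Type*} [CommRing A] [CommRing B] (φ : A →+* B) (f : ℕ → ℤ) (θ : A)
    (k : ℕ) : φ (horner f θ k) = horner f (φ θ) k := by
  simp [horner]

lemma aeval_fpoly {A : Type*} [CommRing A] [Algebra ℚ A] (n : ℕ) (f : ℕ → ℤ) (x : A) :
    aeval x (fpoly n f) = horner f x n := by
  simp [fpoly, horner]

lemma horner_th (n : ℕ) (f : ℕ → ℤ) : horner f (th n f) n = 0 := by
  rw [← aeval_fpoly, th, AdjoinRoot.aeval_eq, AdjoinRoot.mk_self]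

lemma horner_eq_zeta (n : ℕ) (f : ℕ → ℤ) {k : ℕ} (hk : k ≠ 0) :
    horner f (th n f) k = zeta n f k + f k := by
  simp [horner, zeta, hk, Finset.sum_range_succ]

lemma zeta_mem_Rf {n k : ℕ} (f : ℕ → ℤ) (hk : k < n) : zeta n f k ∈ Rf n f :=
  Submodule.subset_span ⟨⟨k, hk⟩, rfl⟩

lemma intCast_mem_Rf {n : ℕ} (hn : 0 < n) (f : ℕ → ℤ) (m : ℤ) : (m : Qf n f) ∈ Rf n f := by
  have h := (Rf n f).smul_mem m (zeta_mem_Rf f hn)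
  simpa [zeta] using h

lemma intCast_mul_mem_Rf {n : ℕ} {f : ℕ → ℤ} (m : ℤ) {x : Qf n f} (hx : x ∈ Rf n f) :
    (m : Qf n f) * x ∈ Rf n f := by
  simpa using (Rf n f).smul_mem m hx

lemma horner_mem_Rf {n k : ℕ} (hn : 0 < n) (f : ℕ → ℤ) (hk : k ≤ n) :
    horner f (th n f) k ∈ Rf n f := by
  rcases hk.lt_or_eq with hk | rfl
  · rcases eq_or_ne k 0 with rfl | h0
    · simpa [horner] using intCast_mem_Rf hn f (f 0)
    · rw [horner_eq_zeta n f h0]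
      exact add_mem (zeta_mem_Rf f hk) (intCast_mem_Rf hn f _)
  · rw [horner_th]
    exact zero_mem _

lemma linear_mul_horner_mem_Rf {n k : ℕ} (f : ℕ → ℤ) (hk : k < n) (a c : ℤ) :
    (a - c * th n f) * horner f (th n f) k ∈ Rf n f := by
  have hn : 0 < n := by omega
  have h : (a - c * th n f) * horner f (th n f) k =
      a * horner f (th n f) k - c * (horner f (th n f) (k + 1) - (f (k + 1) : ℤ)) := by
    rw [horner_succ]; ring
  rw [h]
  exact sub_mem (intCast_mul_mem_Rf _ (horner_mem_Rf hn f hk.le))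
    (intCast_mul_mem_Rf _ (sub_mem (horner_mem_Rf hn f hk) (intCast_mem_Rf hn f _)))

lemma IsTransform.of_binForm {n : ℕ} {f g : ℕ → ℤ} {a b c d : ℤ}
    (hg : binForm n g =
      MvPolynomial.bind₁
        (fun j : Fin 2 =>
          if j = 0 then MvPolynomial.C a * MvPolynomial.X 0 + MvPolynomial.C b * MvPolynomial.X 1
          else MvPolynomial.C c * MvPolynomial.X 0 + MvPolynomial.C d * MvPolynomial.X 1)
        (binForm n f)) : IsTransform n f g a b c d := by
  intro A _ x y
  have h := congrArg (MvPolynomial.aeval ![x, y]) hg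
  simpa [binForm, formEval, MvPolynomial.aeval_bind₁] using h

lemma IsTransform.inverse {n : ℕ} {f g : ℕ → ℤ} {a b c d : ℤ} (h : IsTransform n f g a b c d)
    {ε : ℤ} (hε : ε * (a * d - b * c) = 1) :
    IsTransform n g f (ε * d) (-(ε * b)) (-(ε * c)) (ε * a) := by
  intro A _ x y
  rw [h]
  have hε' : (ε : A) * (a * d - b * c) = 1 := by exact_mod_cast congrArg (Int.cast (R := A)) hε
  congr 1 <;> push_cast
  · linear_combination (-x) * hε'
  · linear_combination (-y) * hε'

lemma isUnit_linear {n : ℕ} {f g : ℕ → ℤ} {a b c d : ℤ} (h : IsTransform n f g a b c d)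
    (hg0 : g 0 ≠ 0) : IsUnit ((a : Qf n f) - c * th n f) := by
  have h1 := h (Qf n f) 1 0
  rw [formEval_one_zero, formEval_eq n f (th n f), horner_th] at h1
  simp only [mul_one, mul_zero, add_zero, zero_mul, zero_add] at h1
  rw [mul_comm (th n f)] at h1
  refine isUnit_of_dvd_unit (Dvd.intro _ h1.symm) ?_
  have h2 : IsUnit (g 0 : ℚ) := by simpa using hg0
  simpa using h2.map (algebraMap ℚ (Qf n f))

/-- The factorisation of the transformed form over `Q_f`. -/
lemma formEval_transform {n : ℕ} {f g : ℕ → ℤ} {a b c d : ℤ} (h : IsTransform n f g a b c d)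
    {t : Qf n f} (ht : t * (a - c * th n f) = d * th n f - b) :
    formEval n g (X : (Qf n f)[X]) 1 = (X - C t) * ∑ k ∈ Finset.range n,
      C ((a - c * th n f) * horner f (th n f) k) *
        ((C a * X + C b) ^ (n - 1 - k) * (C c * X + C d) ^ k : ℤ[X]).map (Int.castRingHom _) := by
  have ht' : C t * ((a : (Qf n f)[X]) - c * C (th n f)) = d * C (th n f) - b := by
    simpa using congrArg C ht
  rw [h, formEval_eq n f (C (th n f)), ← map_horner, horner_th, map_zero, zero_mul, zero_add]
  have h1 : (a : (Qf n f)[X]) * X + (b : (Qf n f)[X]) * 1 -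
      C (th n f) * ((c : (Qf n f)[X]) * X + (d : (Qf n f)[X]) * 1) =
      (X - C t) * C (a - c * th n f) := by
    simp only [map_sub, map_mul, map_intCast]
    linear_combination ht'
  rw [h1, mul_assoc, Finset.mul_sum]
  refine congrArg ((X - C t) * ·) (Finset.sum_congr rfl fun k _ => ?_)
  rw [← map_horner]
  simp only [Polynomial.map_mul, Polynomial.map_pow, Polynomial.map_add, map_X, eq_intCast,
    Polynomial.map_intCast, map_mul, mul_one, mul_assoc]

lemma coeff_transform_mem_Rf {n : ℕ} (f : ℕ → ℤ) (a c : ℤ) (W : ℕ → ℤ[X]) (j : ℕ) :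
    (∑ k ∈ Finset.range n, C ((a - c * th n f) * horner f (th n f) k) *
      (W k).map (Int.castRingHom (Qf n f))).coeff j ∈ Rf n f := by
  rw [finsetSum_coeff]
  refine sum_mem fun k hk => ?_
  rw [coeff_C_mul, coeff_map, mul_comm]
  exact intCast_mul_mem_Rf _ (linear_mul_horner_mem_Rf f (Finset.mem_range.1 hk) a c)

lemma horner_transform_mem_Rf {n : ℕ} {f g : ℕ → ℤ} {a b c d : ℤ}
    (h : IsTransform n f g a b c d) {t : Qf n f} (ht : t * (a - c * th n f) = d * th n f - b)
    (htg : horner g t n = 0) {k : ℕ} (hk : k < n) : horner g t k ∈ Rf n f := by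
  have h1 := formEval_transform h ht
  rw [formEval_eq n g (C t), ← map_horner, htg, map_zero, zero_mul, zero_add, mul_one] at h1
  have h2 := (monic_X_sub_C t).isRegular.left h1
  have h3 := congrArg (fun p => coeff p (n - 1 - k)) h2
  have h4 : (∑ i ∈ Finset.range n, horner g (C t) i * X ^ (n - 1 - i) * 1 ^ i).coeff (n - 1 - k) =
      horner g t k := by
    rw [finsetSum_coeff, Finset.sum_eq_single_of_mem k (Finset.mem_range.2 hk)]
    · rw [← map_horner, one_pow, mul_one, coeff_C_mul_X_pow, if_pos rfl]
    · intro i hi hik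
      rw [← map_horner, one_pow, mul_one, coeff_C_mul_X_pow, if_neg]
      have := Finset.mem_range.1 hi
      omega
  rw [← h4]
  exact h3 ▸ coeff_transform_mem_Rf f a c _ _

/-- A transformation of forms induces a homomorphism `Q_g → Q_f` carrying `R_g` into `R_f`. -/
lemma exists_algHom_of_isTransform {n : ℕ} {f g : ℕ → ℤ} {a b c d : ℤ}
    (h : IsTransform n f g a b c d) (hg0 : g 0 ≠ 0) :
    ∃ φ : Qf n g →ₐ[ℚ] Qf n f, φ (th n g) * (a - c * th n f) = d * th n f - b ∧
      ∀ x ∈ Rf n g, φ x ∈ Rf n f := by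
  obtain ⟨u, hu⟩ := (isUnit_linear h hg0).exists_left_inv
  set t := (d * th n f - b) * u with ht_def
  have ht : t * (a - c * th n f) = d * th n f - b := by rw [ht_def, mul_assoc, hu, mul_one]
  have htg : horner g t n = 0 := by
    have h1 := congrArg (evalRingHom t) (formEval_transform h ht)
    rw [formEval_one_right, map_horner, map_mul] at h1
    simpa using h1
  refine ⟨AdjoinRoot.liftAlgHom _ (Algebra.ofId ℚ _) t ?_, ?_⟩
  · exact (aeval_fpoly n g t).trans htg
  set φ := AdjoinRoot.liftAlgHom (fpoly n g) (Algebra.ofId ℚ (Qf n f)) t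
    ((aeval_fpoly n g t).trans htg) with hφ
  have hroot : φ (th n g) = t := AdjoinRoot.liftAlgHom_root ..
  refine ⟨by rw [hroot, ht], fun x hx => ?_⟩
  have hle : Rf n g ≤ (Rf n f).comap φ.toRingHom.toAddMonoidHom.toIntLinearMap := by
    refine Submodule.span_le.2 ?_
    rintro _ ⟨⟨k, hk⟩, rfl⟩
    change φ (zeta n g k) ∈ Rf n f
    rcases eq_or_ne k 0 with rfl | h0
    · simpa [zeta] using intCast_mem_Rf hk f 1
    · rw [eq_sub_of_add_eq (horner_eq_zeta n g h0).symm, map_sub, map_intCast]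
      refine sub_mem ?_ (intCast_mem_Rf (by omega) f _)
      have := horner_transform_mem_Rf h ht htg hk
      rwa [← hroot, ← AlgHom.coe_toRingHom, ← map_horner] at this
  exact hle hx

lemma algHom_comp_eq_id {n : ℕ} {f g : ℕ → ℤ} {a b c d a' b' c' d' : ℤ}
    {φ : Qf n g →ₐ[ℚ] Qf n f} {ψ : Qf n f →ₐ[ℚ] Qf n g}
    (hφ : φ (th n g) * (a - c * th n f) = d * th n f - b)
    (hψ : ψ (th n f) * (a' - c' * th n g) = d' * th n g - b')
    (h₁ : a' * a + c' * b = 1) (h₂ : a' * c + c' * d = 0)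
    (h₃ : d' * b + b' * a = 0) (h₄ : d' * d + b' * c = 1) (x : Qf n f) : φ (ψ x) = x := by
  have e₁ : (a' : Qf n f) * a + c' * b = 1 := by exact_mod_cast congrArg (Int.cast (R := Qf n f)) h₁
  have e₂ : (a' : Qf n f) * c + c' * d = 0 := by exact_mod_cast congrArg (Int.cast (R := Qf n f)) h₂
  have e₃ : (d' : Qf n f) * b + b' * a = 0 := by exact_mod_cast congrArg (Int.cast (R := Qf n f)) h₃
  have e₄ : (d' : Qf n f) * d + b' * c = 1 := by exact_mod_cast congrArg (Int.cast (R := Qf n f)) h₄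
  have h := congrArg φ hψ
  simp only [map_mul, map_sub, map_intCast] at h
  have key : φ (ψ (th n f)) = th n f := by
    linear_combination (a - c * th n f) * h + (c' * φ (ψ (th n f)) + d') * hφ -
      φ (ψ (th n f)) * e₁ + φ (ψ (th n f)) * th n f * e₂ - e₃ + th n f * e₄
  have : φ.comp ψ = AlgHom.id ℚ _ := AdjoinRoot.algHom_ext key
  exact DFunLike.congr_fun this x

/-- If `ad - bc = ±1` and `g₀, …, g_n` are the coefficients of the transformed form
`f^g(x, y) = f(ax + by, cx + dy)`, with `g₀ ≠ 0`, then there is a ring isomorphism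
`R_f ≅ R_{f^g}`. -/
theorem stmt14 (n : ℕ) (hn : 2 ≤ n) (f : ℕ → ℤ) (hf0 : f 0 ≠ 0)
    (a b c d : ℤ) (hdet : a * d - b * c = 1 ∨ a * d - b * c = -1)
    (g : ℕ → ℤ) (hg0 : g 0 ≠ 0)
    (hg : binForm n g =
      MvPolynomial.bind₁
        (fun j : Fin 2 =>
          if j = 0 then MvPolynomial.C a * MvPolynomial.X 0 + MvPolynomial.C b * MvPolynomial.X 1
          else MvPolynomial.C c * MvPolynomial.X 0 + MvPolynomial.C d * MvPolynomial.X 1)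
        (binForm n f)) :
    ∃ e : Rf n f ≃ₗ[ℤ] Rf n g,
      (∀ x : Rf n f, (x : Qf n f) = 1 → (e x : Qf n g) = 1) ∧
      ∀ x y z : Rf n f, (x : Qf n f) * (y : Qf n f) = (z : Qf n f) →
        (e x : Qf n g) * (e y : Qf n g) = (e z : Qf n g) := by
  have h := IsTransform.of_binForm hg
  obtain ⟨ε, hε⟩ : ∃ ε : ℤ, ε * (a * d - b * c) = 1 := by
    rcases hdet with h | h
    · exact ⟨1, by rw [h]; rfl⟩
    · exact ⟨-1, by rw [h]; rfl⟩
  obtain ⟨φ, hφ, hφR⟩ := exists_algHom_of_isTransform h hg0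
  obtain ⟨ψ, hψ, hψR⟩ := exists_algHom_of_isTransform (h.inverse hε) hf0
  have hφψ := algHom_comp_eq_id hφ hψ (by linear_combination hε) (by ring) (by ring)
    (by linear_combination hε)
  have hψφ := algHom_comp_eq_id hψ hφ (by linear_combination hε) (by ring) (by ring)
    (by linear_combination hε)
  refine ⟨LinearEquiv.ofLinearMap
    (ψ.toRingHom.toAddMonoidHom.toIntLinearMap.restrict hψR)
    (φ.toRingHom.toAddMonoidHom.toIntLinearMap.restrict hφR)
    (LinearMap.ext fun x => Subtype.ext (hψφ x)) (LinearMap.ext fun x => Subtype.ext (hφψ x)),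
    fun x hx => ?_, fun x y z hxyz => ?_⟩
  · change ψ x = 1
    rw [hx, map_one]
  · change ψ x * ψ y = ψ z
    rw [← hxyz, map_mul]

end
end

section
/- Let a, b, c, d be integers with ad − bc = ±1, and let g_0, …, g_n ∈ ℤ be the coefficients of the transformed form f^g(x, y) := f(ax + by, cx + dy), and assume g_0 ≠ 0. Let R_{f^g} and I_{f^g} be constructed from g_0, …, g_n exactly as R_f and I_f are constructed from f_0, …, f_n. Then there exist a ring isomorphism φ : R_f ≅ R_{f^g} and an additive group isomorphism ψ : I_f ≅ I_{f^g} satisfying ψ(r·x) = φ(r)·ψ(x) for all r ∈ R_f and x ∈ I_f; that is, the pair (ring, module) is a GL₂(ℤ)-invariant of the form. -/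
open Polynomial

noncomputable section

/-- `I_f`, the `R_f`-submodule of `Q_f` generated by `1` and `θ`,
as a ℤ-submodule of `Q_f`. -/
def If (n : ℕ) (f : ℕ → ℤ) : Submodule ℤ (Qf n f) :=
  Rf n f * Submodule.span ℤ {1, th n f}

namespace BinaryForm

open MvPolynomial (bind₁)

variable {A : Type*} [CommRing A]

/-- `f₀ t^k + f₁ t^(k-1) + ⋯ + f_k`. -/
def horner (f : ℕ → ℤ) (t : A) (k : ℕ) : A :=
  ∑ i ∈ Finset.range (k + 1), (f i : A) * t ^ (k - i)

/-- The quotient of the binary form `f` by `x - t y`, for a root `t` of `f`. -/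
def cofactor (n : ℕ) (f : ℕ → ℤ) (t : A) : MvPolynomial (Fin 2) A :=
  ∑ k ∈ Finset.range n,
    MvPolynomial.C (horner f t k) * MvPolynomial.X 0 ^ (n - 1 - k) * MvPolynomial.X 1 ^ k

/-- The ℤ-span of the coefficients of a polynomial. -/
def coeffSpan (P : MvPolynomial (Fin 2) A) : Submodule ℤ A :=
  Submodule.span ℤ (Set.range fun m => P.coeff m)

/-- The substitution `(x, y) ↦ (ax + by, cx + dy)`. -/
def linSubst (A : Type*) [CommRing A] (a b c d : ℤ) :
    MvPolynomial (Fin 2) A →ₐ[A] MvPolynomial (Fin 2) A :=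
  bind₁ fun j =>
    if j = 0 then
      MvPolynomial.C (a : A) * MvPolynomial.X 0 + MvPolynomial.C (b : A) * MvPolynomial.X 1
    else MvPolynomial.C (c : A) * MvPolynomial.X 0 + MvPolynomial.C (d : A) * MvPolynomial.X 1

@[simp] lemma linSubst_X_zero (a b c d : ℤ) :
    linSubst A a b c d (MvPolynomial.X 0) =
      MvPolynomial.C (a : A) * MvPolynomial.X 0 + MvPolynomial.C (b : A) * MvPolynomial.X 1 := by
  simp [linSubst]

@[simp] lemma linSubst_X_one (a b c d : ℤ) :
    linSubst A a b c d (MvPolynomial.X 1) =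
      MvPolynomial.C (c : A) * MvPolynomial.X 0 + MvPolynomial.C (d : A) * MvPolynomial.X 1 := by
  simp [linSubst]

lemma map_linSubst (a b c d : ℤ) (P : MvPolynomial (Fin 2) ℤ) :
    MvPolynomial.map (Int.castRingHom A) (linSubst ℤ a b c d P) =
      linSubst A a b c d (MvPolynomial.map (Int.castRingHom A) P) := by
  rw [linSubst, linSubst, MvPolynomial.map_bind₁]
  congr 2
  ext1 j
  fin_cases j <;> simp

lemma linSubst_C (a b c d : ℤ) (r : A) :
    linSubst A a b c d (MvPolynomial.C r) = MvPolynomial.C r := by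
  simp [linSubst]

lemma horner_zero (f : ℕ → ℤ) (t : A) : horner f t 0 = f 0 := by
  simp [horner]

lemma horner_succ (f : ℕ → ℤ) (t : A) (k : ℕ) :
    horner f t (k + 1) = t * horner f t k + f (k + 1) := by
  unfold horner
  rw [Finset.sum_range_succ _ (k + 1), Finset.mul_sum]
  congr 1
  · refine Finset.sum_congr rfl fun i hi => ?_
    have : k + 1 - i = (k - i) + 1 := by have := Finset.mem_range.1 hi; omega
    rw [this, pow_succ]
    ring
  · simp

lemma sub_mul_cofactor (n : ℕ) (f : ℕ → ℤ) (t : A) (ht : horner f t n = 0) :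
    (MvPolynomial.X 0 - MvPolynomial.C t * MvPolynomial.X 1) * cofactor n f t =
      MvPolynomial.map (Int.castRingHom A) (binForm n f) := by
  have key : ∀ k ∈ Finset.range n,
      (MvPolynomial.X 0 - MvPolynomial.C t * MvPolynomial.X 1) *
        (MvPolynomial.C (horner f t k) * MvPolynomial.X 0 ^ (n - 1 - k) * MvPolynomial.X 1 ^ k) =
      (MvPolynomial.C (horner f t k) * MvPolynomial.X 0 ^ (n - k) * MvPolynomial.X 1 ^ k -
        MvPolynomial.C (horner f t (k + 1)) * MvPolynomial.X 0 ^ (n - (k + 1)) *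
          MvPolynomial.X 1 ^ (k + 1)) +
      (MvPolynomial.C (f (k + 1) : A) * MvPolynomial.X 0 ^ (n - (k + 1)) *
        MvPolynomial.X 1 ^ (k + 1) : MvPolynomial (Fin 2) A) := by
    intro k hk
    have h1 : n - k = (n - 1 - k) + 1 := by have := Finset.mem_range.1 hk; omega
    have h2 : n - (k + 1) = n - 1 - k := by omega
    rw [h1, h2, horner_succ, MvPolynomial.C_add, MvPolynomial.C_mul]
    ring
  unfold cofactor binForm
  rw [Finset.mul_sum, Finset.sum_congr rfl key, Finset.sum_add_distrib, Finset.sum_range_sub',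
    Finset.sum_range_succ', map_add, map_sum, ht, horner_zero]
  simp
  ring

lemma sub_mul_cancel (t : A) {P Q : MvPolynomial (Fin 2) A}
    (h : (MvPolynomial.X 0 - MvPolynomial.C t * MvPolynomial.X 1) * P =
      (MvPolynomial.X 0 - MvPolynomial.C t * MvPolynomial.X 1) * Q) : P = Q := by
  let σ (s : A) : MvPolynomial (Fin 2) A →ₐ[A] MvPolynomial (Fin 2) A :=
    bind₁ fun j => if j = 0 then MvPolynomial.X 0 + MvPolynomial.C s * MvPolynomial.X 1
      else MvPolynomial.X 1
  have hσ : (σ (-t)).comp (σ t) = AlgHom.id A _ := by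
    ext j : 1
    fin_cases j <;> simp [σ]
  have hσ' (P) : σ (-t) (σ t P) = P := DFunLike.congr_fun hσ P
  have h' := congrArg (σ t) h
  have h0 : σ t (MvPolynomial.X 0 - MvPolynomial.C t * MvPolynomial.X 1) = MvPolynomial.X 0 := by
    simp [σ]
  rw [map_mul, map_mul, h0] at h'
  have h2 : σ t P = σ t Q := MvPolynomial.X_mul_cancel_left_iff.1 h'
  rw [← hσ' P, h2, hσ']

lemma coeffSpan_linSubst_le (a b c d : ℤ) (P : MvPolynomial (Fin 2) A) :
    coeffSpan (linSubst A a b c d P) ≤ coeffSpan P := by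
  unfold coeffSpan
  rw [Submodule.span_le]
  rintro _ ⟨m, rfl⟩
  have hmon (s : Fin 2 →₀ ℕ) (r : A) : linSubst A a b c d (MvPolynomial.monomial s r) =
      MvPolynomial.C r * MvPolynomial.map (Int.castRingHom A)
        (linSubst ℤ a b c d (MvPolynomial.monomial s 1)) := by
    rw [map_linSubst, MvPolynomial.map_monomial, ← linSubst_C a b c d, ← map_mul,
      MvPolynomial.C_mul_monomial, map_one, mul_one]
  conv => enter [2]; simp only []; rw [P.as_sum]
  simp only [map_sum, MvPolynomial.coeff_sum, hmon, MvPolynomial.coeff_C_mul,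
    MvPolynomial.coeff_map]
  refine Submodule.sum_mem _ fun s _ => ?_
  rw [mul_comm, eq_intCast, ← zsmul_eq_mul]
  exact Submodule.smul_mem _ _ (Submodule.subset_span ⟨s, rfl⟩)

lemma linSubst_comp_inverse {a b c d ε : ℤ} (hε : ε * (a * d - b * c) = 1)
    (P : MvPolynomial (Fin 2) A) :
    linSubst A (ε * d) (-(ε * b)) (-(ε * c)) (ε * a) (linSubst A a b c d P) = P := by
  have hε' : (ε : MvPolynomial (Fin 2) A) * (a * d - b * c) = 1 := by
    exact_mod_cast congrArg (Int.cast : ℤ → MvPolynomial (Fin 2) A) hε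
  suffices (linSubst A (ε * d) (-(ε * b)) (-(ε * c)) (ε * a)).comp (linSubst A a b c d) =
      AlgHom.id A _ from DFunLike.congr_fun this P
  ext j : 1
  fin_cases j
  · simp
    linear_combination MvPolynomial.X 0 * hε'
  · simp
    linear_combination MvPolynomial.X 1 * hε'

lemma coeffSpan_linSubst {a b c d ε : ℤ} (hε : ε * (a * d - b * c) = 1)
    (P : MvPolynomial (Fin 2) A) :
    coeffSpan (linSubst A a b c d P) = coeffSpan P := by
  refine le_antisymm (coeffSpan_linSubst_le ..) ?_
  conv_lhs => rw [← linSubst_comp_inverse hε P]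
  exact coeffSpan_linSubst_le ..

lemma coeffSpan_C_mul (r : A) (P : MvPolynomial (Fin 2) A) :
    coeffSpan (MvPolynomial.C r * P) = Submodule.span ℤ {r} * coeffSpan P := by
  rw [coeffSpan, coeffSpan, Submodule.span_mul_span]
  congr 1
  ext x
  simp

lemma coeffSpan_cofactor (n : ℕ) (f : ℕ → ℤ) (t : A) :
    coeffSpan (cofactor n f t) = Submodule.span ℤ (Set.range fun k : Fin n => horner f t k) := by
  have hmon (k : ℕ) : (MvPolynomial.C (horner f t k) * MvPolynomial.X 0 ^ (n - 1 - k) *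
      MvPolynomial.X 1 ^ k : MvPolynomial (Fin 2) A) = MvPolynomial.monomial
        (Finsupp.single 0 (n - 1 - k) + Finsupp.single 1 k) (horner f t k) := by
    rw [MvPolynomial.X_pow_eq_monomial, MvPolynomial.X_pow_eq_monomial,
      MvPolynomial.C_mul_monomial, MvPolynomial.monomial_mul]
    simp
  have hc (m : Fin 2 →₀ ℕ) : (cofactor n f t).coeff m = ∑ k ∈ Finset.range n,
      if Finsupp.single 0 (n - 1 - k) + Finsupp.single 1 k = m then horner f t k else 0 := by
    simp only [cofactor, MvPolynomial.coeff_sum, hmon, MvPolynomial.coeff_monomial]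
  unfold coeffSpan
  refine le_antisymm (Submodule.span_le.2 ?_) (Submodule.span_le.2 ?_)
  · rintro _ ⟨m, rfl⟩
    simp only [hc]
    refine Submodule.sum_mem _ fun k hk => ?_
    split_ifs
    · exact Submodule.subset_span ⟨⟨k, Finset.mem_range.1 hk⟩, rfl⟩
    · exact Submodule.zero_mem _
  · rintro _ ⟨k, rfl⟩
    refine Submodule.subset_span ⟨Finsupp.single 0 (n - 1 - k) + Finsupp.single 1 (k : ℕ), ?_⟩
    simp only [hc]
    rw [Finset.sum_eq_single_of_mem (k : ℕ) (Finset.mem_range.2 k.2)]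
    · simp
    · intro j _ hj
      rw [if_neg]
      intro h
      exact hj (by simpa using DFunLike.congr_fun h 1)

/-- The analogue of `Rf` for an arbitrary root `t` of `f`, in a form which makes the action
of `GL₂(ℤ)` visible. -/
def rootRing (n : ℕ) (f : ℕ → ℤ) (t : A) : Submodule ℤ A :=
  Submodule.span ℤ {1} ⊔ coeffSpan (cofactor n f t) * Submodule.span ℤ {1, t}

section Transform

variable {n : ℕ} {f g : ℕ → ℤ} {a b c d ε : ℤ} {t s : A}

lemma span_one_root (hε : ε * (a * d - b * c) = 1) (hts : (c * s + d) * t = a * s + b) :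
    Submodule.span ℤ {1, s} =
      Submodule.span ℤ {(c * s + d : A)} * Submodule.span ℤ {1, t} := by
  have hε' : (ε : A) * (a * d - b * c) = 1 := by exact_mod_cast congrArg (Int.cast : ℤ → A) hε
  rw [Submodule.span_mul_span, Set.singleton_mul, Set.image_pair, hts, mul_one]
  refine le_antisymm (Submodule.span_le.2 ?_) (Submodule.span_le.2 ?_)
  · rintro x (rfl | rfl)
    · refine Submodule.mem_span_pair.2 ⟨ε * a, -(ε * c), ?_⟩
      simp only [zsmul_eq_mul]
      push_cast
      linear_combination hε'
    · refine Submodule.mem_span_pair.2 ⟨-(ε * b), ε * d, ?_⟩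
      simp only [zsmul_eq_mul]
      push_cast
      linear_combination x * hε'
  · rintro x (rfl | rfl)
    · exact Submodule.mem_span_pair.2 ⟨d, c, by simp only [zsmul_eq_mul]; ring⟩
    · exact Submodule.mem_span_pair.2 ⟨b, a, by simp only [zsmul_eq_mul]; ring⟩

lemma C_mul_cofactor (hε : ε * (a * d - b * c) = 1)
    (hts : (c * s + d) * t = a * s + b)
    (ht : horner f t n = 0) (hs : horner g s n = 0)
    (hg : MvPolynomial.map (Int.castRingHom A) (binForm n g) =
      linSubst A a b c d (MvPolynomial.map (Int.castRingHom A) (binForm n f))) :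
    MvPolynomial.C (ε * (c * s + d) : A) * cofactor n g s =
      linSubst A a b c d (cofactor n f t) := by
  have hε' : (ε : MvPolynomial (Fin 2) A) * (a * d - b * c) = 1 := by
    exact_mod_cast congrArg (Int.cast : ℤ → MvPolynomial (Fin 2) A) hε
  have hts' := congrArg (MvPolynomial.C (σ := Fin 2)) hts
  simp only [map_mul, map_add, map_intCast] at hts'
  rw [← sub_mul_cofactor n g s hs, ← sub_mul_cofactor n f t ht, map_mul, map_sub, map_mul,
    linSubst_C, linSubst_X_zero, linSubst_X_one] at hg
  simp only [map_intCast] at hg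
  apply sub_mul_cancel s
  simp only [map_mul, map_add, map_intCast]
  set x : MvPolynomial (Fin 2) A := MvPolynomial.X 0
  set y : MvPolynomial (Fin 2) A := MvPolynomial.X 1
  set S : MvPolynomial (Fin 2) A := MvPolynomial.C s
  linear_combination ε * (c * S + d) * hg
    - ε * (c * x + d * y) * linSubst A a b c d (cofactor n f t) * hts'
    + (x - S * y) * linSubst A a b c d (cofactor n f t) * hε'

lemma rootRing_eq (hε : ε * (a * d - b * c) = 1)
    (hts : (c * s + d) * t = a * s + b)
    (ht : horner f t n = 0) (hs : horner g s n = 0)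
    (hg : MvPolynomial.map (Int.castRingHom A) (binForm n g) =
      linSubst A a b c d (MvPolynomial.map (Int.castRingHom A) (binForm n f))) :
    rootRing n g s = rootRing n f t := by
  have hspan : Submodule.span ℤ {(ε * (c * s + d) : A)} = Submodule.span ℤ {(c * s + d : A)} := by
    refine le_antisymm ?_ ?_ <;> rw [Submodule.span_singleton_le_iff_mem,
      Submodule.mem_span_singleton]
    · exact ⟨ε, zsmul_eq_mul ..⟩
    · refine ⟨a * d - b * c, ?_⟩
      have hε' : (ε : A) * (a * d - b * c) = 1 := by
        exact_mod_cast congrArg (Int.cast : ℤ → A) hε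
      rw [zsmul_eq_mul]
      push_cast
      linear_combination (c * s + d) * hε'
  rw [rootRing, rootRing, ← coeffSpan_linSubst hε (cofactor n f t),
    ← C_mul_cofactor hε hts ht hs hg, coeffSpan_C_mul, hspan, span_one_root hε hts]
  congr 1
  rw [mul_assoc, mul_left_comm]

end Transform

lemma rootRing_eq_span {n : ℕ} (hn : 1 ≤ n) {f : ℕ → ℤ} {t : A} (ht : horner f t n = 0) :
    rootRing n f t = Submodule.span ℤ
      (Set.range fun k : Fin n => if (k : ℕ) = 0 then 1 else t * horner f t (k - 1)) := by
  set S := Submodule.span ℤ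
    (Set.range fun k : Fin n => if (k : ℕ) = 0 then (1 : A) else t * horner f t (k - 1))
  have h1 : (1 : A) ∈ S := Submodule.subset_span ⟨⟨0, hn⟩, by simp⟩
  have hint (m : ℤ) : (m : A) ∈ S := by simpa using S.smul_mem m h1
  have hmul (k : ℕ) (hk : k < n) : t * horner f t k ∈ S := by
    rcases (show k + 1 ≤ n from hk).lt_or_eq with h | h
    · exact Submodule.subset_span ⟨⟨k + 1, h⟩, by simp⟩
    · have := horner_succ f t k
      rw [h, ht] at this
      rw [show t * horner f t k = ((-f n : ℤ) : A) by
        push_cast; linear_combination -this]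
      exact hint _
  have hhor (k : ℕ) (hk : k < n) : horner f t k ∈ S := by
    cases k with
    | zero => rw [horner_zero]; exact hint _
    | succ k =>
      rw [horner_succ]
      exact S.add_mem (hmul k (by omega)) (hint _)
  rw [rootRing, coeffSpan_cofactor, Submodule.span_mul_span]
  refine le_antisymm (sup_le ?_ (Submodule.span_le.2 ?_)) (Submodule.span_le.2 ?_)
  · simpa [Submodule.span_singleton_le_iff_mem] using h1
  · rintro _ ⟨_, ⟨k, rfl⟩, x, rfl | rfl, rfl⟩
    · simpa using hhor k k.2
    · simpa [mul_comm] using hmul k k.2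
  · rintro _ ⟨k, rfl⟩
    dsimp only
    split_ifs with hk
    · exact Submodule.mem_sup_left (Submodule.mem_span_singleton_self 1)
    · refine Submodule.mem_sup_right (Submodule.subset_span
        ⟨_, ⟨⟨k - 1, by omega⟩, rfl⟩, t, by simp, mul_comm _ _⟩)

lemma map_fpoly (n : ℕ) (f : ℕ → ℤ) (φ : Polynomial ℚ →+* A) :
    φ (fpoly n f) = horner f (φ Polynomial.X) n := by
  simp only [fpoly, horner, map_sum, map_mul, map_pow, map_intCast]

lemma horner_th (n : ℕ) (f : ℕ → ℤ) : horner f (th n f) n = 0 :=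
  (map_fpoly n f (AdjoinRoot.mk (fpoly n f))).symm.trans AdjoinRoot.mk_self

lemma zeta_eq (n : ℕ) (f : ℕ → ℤ) (k : ℕ) :
    zeta n f k = if k = 0 then 1 else th n f * horner f (th n f) (k - 1) := by
  cases k with
  | zero => simp [zeta]
  | succ k =>
    have := horner_succ f (th n f) k
    unfold horner at this
    rw [Finset.sum_range_succ] at this
    simp only [Nat.sub_self, pow_zero, mul_one, add_left_inj] at this
    simpa [zeta, horner] using this

lemma map_horner {B F : Type*} [CommRing B] [FunLike F A B] [RingHomClass F A B] (φ : F)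
    (f : ℕ → ℤ) (t : A) (k : ℕ) : φ (horner f t k) = horner f (φ t) k := by
  simp [horner]

lemma map_Rf {n : ℕ} (hn : 1 ≤ n) {f : ℕ → ℤ} (φ : Qf n f →+* A) :
    (Rf n f).map φ.toIntAlgHom.toLinearMap = rootRing n f (φ (th n f)) := by
  rw [rootRing_eq_span hn (by rw [← map_horner, horner_th, map_zero]), Rf, Submodule.map_span,
    ← Set.range_comp]
  congr 2
  ext k
  simp only [Function.comp_apply, AlgHom.toLinearMap_apply, RingHom.toIntAlgHom_coe, zeta_eq]
  split_ifs <;> simp [map_horner]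

lemma eval_map_binForm (n : ℕ) (f : ℕ → ℤ) (v : Fin 2 → A) :
    MvPolynomial.eval v (MvPolynomial.map (Int.castRingHom A) (binForm n f)) =
      ∑ i ∈ Finset.range (n + 1), (f i : A) * v 0 ^ (n - i) * v 1 ^ i := by
  simp [binForm]

lemma eval_linSubst (a b c d : ℤ) (v : Fin 2 → A) (P : MvPolynomial (Fin 2) A) :
    MvPolynomial.eval v (linSubst A a b c d P) =
      MvPolynomial.eval ![a * v 0 + b * v 1, c * v 0 + d * v 1] P := by
  suffices ((MvPolynomial.aeval v).comp (linSubst A a b c d) : _ →ₐ[A] A) =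
      MvPolynomial.aeval ![a * v 0 + b * v 1, c * v 0 + d * v 1] by
    simpa [MvPolynomial.aeval_eq_eval] using DFunLike.congr_fun this P
  ext j : 1
  fin_cases j <;> simp

section Hom

variable {n : ℕ} {f g : ℕ → ℤ} {a b c d ε : ℤ}

lemma isUnit_denominator [Algebra ℚ A] (hf0 : f 0 ≠ 0) (hε : ε * (a * d - b * c) = 1)
    (hg : binForm n g = linSubst ℤ a b c d (binForm n f)) {s : A} (hs : horner g s n = 0) :
    IsUnit (c * s + d : A) := by
  have h := congrArg (MvPolynomial.eval ![(d : A), -c]) (sub_mul_cofactor n g s hs)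
  rw [hg, map_linSubst, eval_linSubst, eval_map_binForm, Finset.sum_eq_single_of_mem 0 (by simp)]
    at h
  · have hdet : IsUnit (a * d - b * c : A) := by
      refine IsUnit.of_mul_eq_one_right (ε : A) ?_
      exact_mod_cast congrArg (Int.cast : ℤ → A) hε
    have hf : IsUnit (f 0 : A) := by
      have := (IsUnit.mk0 (f 0 : ℚ) (by exact_mod_cast hf0)).map (algebraMap ℚ A)
      simpa using this
    have key : IsUnit ((c * s + d) * MvPolynomial.eval ![(d : A), -c] (cofactor n g s)) := by
      convert hf.mul (hdet.pow n) using 1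
      simp at h
      linear_combination h
    exact isUnit_of_mul_isUnit_left key
  · intro i _ hi
    simp [mul_comm, hi]

lemma exists_algHom (hf0 : f 0 ≠ 0) (hε : ε * (a * d - b * c) = 1)
    (hg : binForm n g = linSubst ℤ a b c d (binForm n f)) :
    ∃ φ : Qf n f →ₐ[ℚ] Qf n g, (c * th n g + d) * φ (th n f) = a * th n g + b := by
  obtain ⟨u, hu⟩ := isUnit_denominator hf0 hε hg (horner_th n g)
  set t : Qf n g := ↑u⁻¹ * (a * th n g + b) with ht
  have hut : u * t = a * th n g + b := by simp [ht]
  clear_value t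
  have hroot : horner f t n = 0 := by
    have h := congrArg (fun P => MvPolynomial.eval ![th n g, 1]
      (MvPolynomial.map (Int.castRingHom (Qf n g)) P)) hg
    simp only [map_linSubst, eval_linSubst, eval_map_binForm] at h
    simp only [Matrix.cons_val_zero, Matrix.cons_val_one, mul_one, one_pow] at h
    rw [← horner, horner_th, ← hu, ← hut] at h
    refine (u ^ n).isUnit.mul_right_eq_zero.1 ?_
    rw [h, horner, Finset.mul_sum]
    refine Finset.sum_congr rfl fun i hi => ?_
    have : (n - i) + i = n := by have := Finset.mem_range.1 hi; omega
    have hpow : (u : Qf n g) ^ n = u ^ (n - i) * u ^ i := by rw [← pow_add, this]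
    rw [Units.val_pow_eq_pow_val, hpow]
    ring
  refine ⟨AdjoinRoot.liftAlgHom _ (Algebra.ofId ℚ _) t ?_, ?_⟩
  · rw [← hroot]
    exact (map_fpoly n f (Polynomial.eval₂RingHom _ t)).trans
      (congrArg (horner f · n) (Polynomial.eval₂_X _ _))
  · rw [← hut, hu]
    exact congrArg _ (AdjoinRoot.liftAlgHom_root ..)

lemma comp_eq_id (hε : ε * (a * d - b * c) = 1)
    (φ : Qf n f →ₐ[ℚ] Qf n g) (hφ : (c * th n g + d) * φ (th n f) = a * th n g + b)
    (ψ : Qf n g →ₐ[ℚ] Qf n f)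
    (hψ : ((-(ε * c) : ℤ) * th n f + (ε * a : ℤ)) * ψ (th n g) =
      (ε * d : ℤ) * th n f + (-(ε * b) : ℤ)) :
    φ.comp ψ = AlgHom.id ℚ _ := by
  apply AdjoinRoot.algHom_ext
  have h := congrArg φ hψ
  have hε' : (ε : Qf n g) * (a * d - b * c) = 1 := by
    exact_mod_cast congrArg (Int.cast : ℤ → Qf n g) hε
  simp only [map_mul, map_add, map_intCast] at h
  push_cast at h
  change φ (ψ (th n g)) = th n g
  linear_combination (c * th n g + d) * h + (ε * c * φ (ψ (th n g)) + ε * d) * hφ +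
    (th n g - φ (ψ (th n g))) * hε'

end Hom

/-- A `GL₂(ℤ)`-substitution induces an isomorphism of the algebras `Q_f`. -/
lemma exists_algEquiv (hf0 : f 0 ≠ 0) (hg0 : g 0 ≠ 0) (hε : ε * (a * d - b * c) = 1)
    (hg : binForm n g = linSubst ℤ a b c d (binForm n f)) :
    ∃ e : Qf n f ≃ₐ[ℚ] Qf n g, (c * th n g + d) * e (th n f) = a * th n g + b := by
  have hεε : ε * ε = 1 := Int.isUnit_mul_self (IsUnit.of_mul_eq_one _ hε)
  have hε₂ : ε * (ε * d * (ε * a) - -(ε * b) * -(ε * c)) = 1 := by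
    linear_combination hε + ε * (a * d - b * c) * hεε
  have hf : binForm n f =
      linSubst ℤ (ε * d) (-(ε * b)) (-(ε * c)) (ε * a) (binForm n g) := by
    rw [hg]
    exact (linSubst_comp_inverse hε _).symm
  obtain ⟨φ, hφ⟩ := exists_algHom hf0 hε hg
  obtain ⟨ψ, hψ⟩ := exists_algHom hg0 hε₂ hf
  refine ⟨AlgEquiv.ofAlgHom φ ψ (comp_eq_id hε φ hφ ψ hψ) (comp_eq_id hε₂ ψ hψ φ ?_), hφ⟩
  rw [show -(ε * -(ε * c)) = c by linear_combination c * hεε,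
    show ε * (ε * d) = d by linear_combination d * hεε,
    show ε * (ε * a) = a by linear_combination a * hεε,
    show -(ε * -(ε * b)) = b by linear_combination b * hεε]
  exact hφ

end BinaryForm

/-- If `ad - bc = ±1` and `g₀, …, g_n` are the coefficients of the transformed form
`f^g(x, y) = f(ax + by, cx + dy)`, with `g₀ ≠ 0`, then there are a ring isomorphism
`φ : R_f ≅ R_{f^g}` and an additive isomorphism `ψ : I_f ≅ I_{f^g}` with
`ψ(r·x) = φ(r)·ψ(x)`: the pair (ring, module) is a `GL₂(ℤ)`-invariant of the form. -/
theorem stmt15 (n : ℕ) (hn : 2 ≤ n) (f : ℕ → ℤ) (hf0 : f 0 ≠ 0)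
    (a b c d : ℤ) (hdet : a * d - b * c = 1 ∨ a * d - b * c = -1)
    (g : ℕ → ℤ) (hg0 : g 0 ≠ 0)
    (hg : binForm n g =
      MvPolynomial.bind₁
        (fun j : Fin 2 =>
          if j = 0 then MvPolynomial.C a * MvPolynomial.X 0 + MvPolynomial.C b * MvPolynomial.X 1
          else MvPolynomial.C c * MvPolynomial.X 0 + MvPolynomial.C d * MvPolynomial.X 1)
        (binForm n f)) :
    ∃ (φ : Rf n f ≃ₗ[ℤ] Rf n g) (ψ : If n f ≃ₗ[ℤ] If n g),
      (∀ x : Rf n f, (x : Qf n f) = 1 → (φ x : Qf n g) = 1) ∧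
      (∀ x y z : Rf n f, (x : Qf n f) * (y : Qf n f) = (z : Qf n f) →
        (φ x : Qf n g) * (φ y : Qf n g) = (φ z : Qf n g)) ∧
      ∀ (r : Rf n f) (x z : If n f), (r : Qf n f) * (x : Qf n f) = (z : Qf n f) →
        (φ r : Qf n g) * (ψ x : Qf n g) = (ψ z : Qf n g) := by
  obtain ⟨ε, hε⟩ : ∃ ε : ℤ, ε * (a * d - b * c) = 1 := by
    rcases hdet with h | h
    · exact ⟨1, by rw [h, one_mul]⟩
    · exact ⟨-1, by rw [h]; norm_num⟩
  have hgL : binForm n g = BinaryForm.linSubst ℤ a b c d (binForm n f) := hg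
  have hs := BinaryForm.horner_th n g
  obtain ⟨u, hu⟩ := BinaryForm.isUnit_denominator hf0 hε hgL hs
  obtain ⟨e, he⟩ := BinaryForm.exists_algEquiv hf0 hg0 hε hgL
  let E : Qf n f ≃ₐ[ℤ] Qf n g := (e : Qf n f ≃+* Qf n g).toIntAlgEquiv
  let M : Qf n f ≃ₗ[ℤ] Qf n g :=
    ((e : Qf n f ≃+ Qf n g).trans (AddAut.mulLeft u)).toIntLinearEquiv
  have hR : (Rf n f).map E.toAlgHom.toLinearMap = Rf n g := by
    have ht : BinaryForm.horner f (e (th n f)) n = 0 := by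
      rw [← BinaryForm.map_horner, BinaryForm.horner_th, map_zero]
    have h₁ := BinaryForm.map_Rf (by omega) (e : Qf n f →+* Qf n g)
    have h₂ := BinaryForm.map_Rf (n := n) (f := g) (by omega) (RingHom.id (Qf n g))
    have h₃ := BinaryForm.rootRing_eq hε he ht hs (by
      rw [hgL, BinaryForm.map_linSubst])
    exact h₁.trans (h₃.symm.trans (h₂.symm.trans (Submodule.map_id _)))
  have hI : (If n f).map (M : Qf n f →ₗ[ℤ] Qf n g) = If n g := by
    have hEI : (If n f).map E.toAlgHom.toLinearMap =
        Rf n g * Submodule.span ℤ {1, e (th n f)} := by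
      rw [If, Submodule.map_mul, hR, Submodule.map_span, Set.image_pair]
      congr 3
      exact map_one e
    have hMI : (If n f).map (M : Qf n f →ₗ[ℤ] Qf n g) =
        Submodule.span ℤ {(u : Qf n g)} * (If n f).map E.toAlgHom.toLinearMap := by
      ext x
      rw [Submodule.mem_span_singleton_mul]
      simp only [Submodule.mem_map, exists_exists_and_eq_and]
      rfl
    rw [hMI, hEI, mul_left_comm, hu, ← BinaryForm.span_one_root hε he, If]
  refine ⟨(E.toLinearEquiv.submoduleMap _).trans (LinearEquiv.ofEq _ _ hR),
    (M.submoduleMap _).trans (LinearEquiv.ofEq _ _ hI), ?_, ?_, ?_⟩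
  · intro x hx
    change e x = 1
    rw [hx, map_one]
  · intro x y z h
    change e x * e y = e z
    rw [← h, map_mul]
  · intro r x z h
    change e r * (u * e x) = u * e z
    rw [← h, map_mul, mul_left_comm]

end
end

section
/- Assume n ≥ 3 and adopt the convention that ζ_i := 0 in Q_f whenever i ≤ 0 or i ≥ n. Then for every integer k with 0 ≤ k ≤ n, the products appearing below lie in I_f^{n−3} and f_{n−k} = c_y(ζ_{n−k+1}·ζ_{n−2}) + c_y(ζ_{n−k}·ζ_{n−1}) − c_x(ζ_{n−k}·ζ_{n−2}) − c_x(ζ_{n−k−1}·ζ_{n−1}); that is, the coefficients of the binary form f are recovered from the multiplicative structure of R_f acting on the module I_f^{n−3}. -/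
open Polynomial

noncomputable section

/-- `I_f^k`, the `k`-th power of the `R_f`-module `I_f = (1, θ)` under multiplication of
ℤ-submodules of `Q_f` (with `I_f^0 = R_f`). -/
def Ifpow (n : ℕ) (f : ℕ → ℤ) (k : ℕ) : Submodule ℤ (Qf n f) :=
  Rf n f * (Submodule.span ℤ {1, th n f}) ^ k

/-- `ζ_i` for an integer index `i`, with the convention that `ζ_i = 0` whenever
`i ≤ 0` or `i ≥ n`. -/
def zetaZ (n : ℕ) (f : ℕ → ℤ) (i : ℤ) : Qf n f :=
  if 1 ≤ i ∧ i ≤ (n : ℤ) - 1 then zeta n f i.toNat else 0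

/-- The four products `ζ_(n-k+1)·ζ_(n-2)`, `ζ_(n-k)·ζ_(n-1)`, `ζ_(n-k)·ζ_(n-2)`,
`ζ_(n-k-1)·ζ_(n-1)` (with the convention `ζ_i = 0` for `i ≤ 0` or `i ≥ n` applied to
the first factor). -/
def prods (n : ℕ) (f : ℕ → ℤ) (k : ℕ) : Fin 4 → Qf n f :=
  ![zetaZ n f ((n : ℤ) - k + 1) * zeta n f (n - 2),
    zetaZ n f ((n : ℤ) - k) * zeta n f (n - 1),
    zetaZ n f ((n : ℤ) - k) * zeta n f (n - 2),
    zetaZ n f ((n : ℤ) - k - 1) * zeta n f (n - 1)]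

/-- The partial Horner sum `f₀ θ^k + ⋯ + f_(k-1) θ`; it is `ζ_k` for `k ≥ 1` and `0` for `k = 0`. -/
def hornerSum (n : ℕ) (f : ℕ → ℤ) (k : ℕ) : Qf n f :=
  ∑ i ∈ Finset.range k, (f i : Qf n f) * th n f ^ (k - i)

lemma hornerSum_zero (n : ℕ) (f : ℕ → ℤ) : hornerSum n f 0 = 0 := by
  simp [hornerSum]

lemma hornerSum_succ (n : ℕ) (f : ℕ → ℤ) (k : ℕ) :
    hornerSum n f (k + 1) = th n f * (hornerSum n f k + f k) := by
  unfold hornerSum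
  rw [Finset.sum_range_succ, mul_add, Finset.mul_sum]
  congr 1
  · refine Finset.sum_congr rfl fun i hi => ?_
    rw [Nat.succ_sub (Finset.mem_range.mp hi).le, pow_succ]
    ring
  · simp [mul_comm]

lemma hornerSum_self (n : ℕ) (f : ℕ → ℤ) : hornerSum n f n = -(f n : Qf n f) := by
  have h : AdjoinRoot.mk (fpoly n f)
      (∑ i ∈ Finset.range (n + 1), C (f i : ℚ) * X ^ (n - i)) = 0 := AdjoinRoot.mk_self
  simp only [map_sum, map_mul, map_pow, map_intCast, AdjoinRoot.mk_X] at h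
  rw [Finset.sum_range_succ, Nat.sub_self, pow_zero, mul_one] at h
  exact eq_neg_of_add_eq_zero_left h

lemma hornerSum_succ_mul (n : ℕ) (f : ℕ → ℤ) (i j : ℕ) :
    hornerSum n f (i + 1) * hornerSum n f j =
      hornerSum n f i * hornerSum n f (j + 1) + f i * hornerSum n f (j + 1)
        - f j * hornerSum n f (i + 1) := by
  rw [hornerSum_succ, hornerSum_succ]
  ring

lemma zeta_eq_hornerSum (n : ℕ) (f : ℕ → ℤ) {k : ℕ} (hk : k ≠ 0) :
    zeta n f k = hornerSum n f k := by
  simp [zeta, hornerSum, hk]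

lemma Rf_le_Ifpow (n : ℕ) (f : ℕ → ℤ) (k : ℕ) : Rf n f ≤ Ifpow n f k := by
  intro x hx
  have h1 : (1 : Qf n f) ∈ Submodule.span ℤ {1, th n f} :=
    Submodule.subset_span (by simp)
  have h := Submodule.mul_mem_mul hx (Submodule.pow_mem_pow _ h1 k)
  rwa [one_pow, mul_one] at h

/-- `x` lies in `R_f` and is the sum of `a ζ_(n-2) + b ζ_(n-1)` and an integral combination of
`1, θ, …, θ^(n-3)`. -/
def HasCoords (n : ℕ) (f : ℕ → ℤ) (x : Qf n f) (a b : ℤ) : Prop :=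
  x ∈ Rf n f ∧
    x - a * hornerSum n f (n - 2) - b * hornerSum n f (n - 1) ∈
      Submodule.span ℤ (Set.range fun t : Fin (n - 2) => th n f ^ (t : ℕ))

namespace HasCoords

variable {n : ℕ} {f : ℕ → ℤ} {x y : Qf n f} {a b a' b' : ℤ}

lemma sub (hx : HasCoords n f x a b) (hy : HasCoords n f y a' b') :
    HasCoords n f (x - y) (a - a') (b - b') := by
  refine ⟨sub_mem hx.1 hy.1, ?_⟩
  convert sub_mem hx.2 hy.2 using 1
  push_cast
  ring

lemma add (hx : HasCoords n f x a b) (hy : HasCoords n f y a' b') :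
    HasCoords n f (x + y) (a + a') (b + b') := by
  refine ⟨add_mem hx.1 hy.1, ?_⟩
  convert add_mem hx.2 hy.2 using 1
  push_cast
  ring

lemma intCast_mul (m : ℤ) (hx : HasCoords n f x a b) :
    HasCoords n f (m * x) (m * a) (m * b) := by
  refine ⟨?_, ?_⟩
  · simpa only [zsmul_eq_mul] using Submodule.smul_mem _ m hx.1
  · convert Submodule.smul_mem _ m hx.2 using 1
    rw [zsmul_eq_mul]
    push_cast
    ring

lemma zero : HasCoords n f 0 0 0 :=
  ⟨zero_mem _, by simp⟩

lemma intCast (hn : 3 ≤ n) (m : ℤ) : HasCoords n f (m : Qf n f) 0 0 := by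
  have h : HasCoords n f 1 0 0 := by
    refine ⟨Submodule.subset_span ⟨⟨0, by omega⟩, by simp [zeta]⟩, ?_⟩
    exact Submodule.subset_span ⟨⟨0, by omega⟩, by simp⟩
  simpa using h.intCast_mul m

lemma hornerSum (hn : 3 ≤ n) {k : ℕ} (hk : k < n) :
    HasCoords n f (hornerSum n f k)
      (if k = n - 2 then 1 else 0) (if k = n - 1 then 1 else 0) := by
  refine ⟨?_, ?_⟩
  · rcases eq_or_ne k 0 with rfl | h0
    · simp [hornerSum_zero]
    · exact Submodule.subset_span ⟨⟨k, hk⟩, zeta_eq_hornerSum n f h0⟩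
  · rcases eq_or_ne k (n - 2) with h2 | h2
    · have h1 : n - 2 ≠ n - 1 := by omega
      simp [h2, h1]
    rcases eq_or_ne k (n - 1) with h1 | h1
    · have h3 : n - 1 ≠ n - 2 := by omega
      simp [h1, h3]
    simp only [h1, h2, if_false, Int.cast_zero, zero_mul, sub_zero]
    refine Submodule.sum_mem _ fun i _ => ?_
    rw [← zsmul_eq_mul]
    exact Submodule.smul_mem _ _ (Submodule.subset_span ⟨⟨k - i, by omega⟩, rfl⟩)

lemma hornerSum_mul_last (hn : 3 ≤ n) {i : ℕ} (hi : i + 1 < n) :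
    HasCoords n f (_root_.hornerSum n f (i + 1) * _root_.hornerSum n f (n - 1))
      (if i + 1 = n - 1 then -f n else if i + 1 = n - 2 then -f (n - 1) else 0)
      (if i + 1 = n - 1 then -f (n - 1) else 0) := by
  rw [hornerSum_succ_mul, Nat.sub_add_cancel (by omega), hornerSum_self]
  convert (((hornerSum (f := f) hn (k := i) (by omega)).intCast_mul (-f n)).add
    (intCast hn (f i * -f n))).sub
      ((hornerSum hn hi).intCast_mul (f (n - 1))) using 1
  · push_cast
    ring
  · split_ifs <;> omega
  · split_ifs <;> omega

lemma hornerSum_mul_penultimate (hn : 3 ≤ n) {i : ℕ} (hi : i + 1 < n) :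
    HasCoords n f (_root_.hornerSum n f (i + 1) * _root_.hornerSum n f (n - 2))
      (if i + 1 = n - 1 then -f (n - 1) else if i + 1 = n - 2 then -f (n - 2) else 0)
      (if i + 1 = n - 1 then 0 else f i) := by
  rw [hornerSum_succ_mul, show n - 2 + 1 = n - 1 by omega]
  have hprod : HasCoords n f (_root_.hornerSum n f i * _root_.hornerSum n f (n - 1))
      (if i = n - 2 then -f (n - 1) else 0) 0 := by
    rcases i with _ | i
    · rw [hornerSum_zero, zero_mul, if_neg (by omega)]
      exact zero
    · convert hornerSum_mul_last (f := f) hn (i := i) (by omega) using 1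
      · split_ifs <;> omega
      · split_ifs <;> omega
  convert (hprod.add ((hornerSum hn (k := n - 1) (by omega)).intCast_mul (f i))).sub
    ((hornerSum hn hi).intCast_mul (f (n - 2))) using 1
  · split_ifs <;> omega
  · by_cases h : i + 1 = n - 1
    · obtain rfl : i = n - 2 := by omega
      simp [h]
    · simp [h]

lemma zetaZ_mul_last (hn : 3 ≤ n) (m : ℤ) :
    HasCoords n f (zetaZ n f m * zeta n f (n - 1))
      (if m = n - 1 then -f n else if m = n - 2 then -f (n - 1) else 0)
      (if m = n - 1 then -f (n - 1) else 0) := by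
  by_cases hm : 1 ≤ m ∧ m ≤ (n : ℤ) - 1
  · obtain ⟨i, rfl⟩ : ∃ i : ℕ, m = i + 1 := ⟨(m - 1).toNat, by omega⟩
    rw [zetaZ, if_pos hm, show ((i : ℤ) + 1).toNat = i + 1 by omega,
      zeta_eq_hornerSum n f (by omega), zeta_eq_hornerSum n f (by omega)]
    convert hornerSum_mul_last (f := f) hn (i := i) (by omega) using 1
    · split_ifs <;> omega
    · split_ifs <;> omega
  · rw [zetaZ, if_neg hm, zero_mul, if_neg (by omega), if_neg (by omega), if_neg (by omega)]
    exact zero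

lemma zetaZ_mul_penultimate (hn : 3 ≤ n) (m : ℤ) :
    HasCoords n f (zetaZ n f m * zeta n f (n - 2))
      (if m = n - 1 then -f (n - 1) else if m = n - 2 then -f (n - 2) else 0)
      (if 1 ≤ m ∧ m ≤ n - 2 then f (m - 1).toNat else 0) := by
  by_cases hm : 1 ≤ m ∧ m ≤ (n : ℤ) - 1
  · obtain ⟨i, rfl⟩ : ∃ i : ℕ, m = i + 1 := ⟨(m - 1).toNat, by omega⟩
    rw [zetaZ, if_pos hm, show ((i : ℤ) + 1).toNat = i + 1 by omega,
      zeta_eq_hornerSum n f (by omega), zeta_eq_hornerSum n f (by omega)]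
    convert hornerSum_mul_penultimate (f := f) hn (i := i) (by omega) using 1
    · split_ifs <;> omega
    · split_ifs <;> first | omega | simp
  · rw [zetaZ, if_neg hm, zero_mul, if_neg (by omega), if_neg (by omega), if_neg (by omega)]
    exact zero

lemma exists_eq (hn : 3 ≤ n) (hx : HasCoords n f x a b) :
    ∃ c : ℕ → ℤ, x = (∑ t ∈ Finset.range (n - 2), (c t : Qf n f) * th n f ^ t) +
      (a : Qf n f) * zeta n f (n - 2) + (b : Qf n f) * zeta n f (n - 1) := by
  obtain ⟨c, hc⟩ := (Submodule.mem_span_range_iff_exists_fun ℤ).mp hx.2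
  refine ⟨fun t => if h : t < n - 2 then c ⟨t, h⟩ else 0, ?_⟩
  rw [Finset.sum_range, zeta_eq_hornerSum n f (by omega), zeta_eq_hornerSum n f (by omega)]
  simp only [zsmul_eq_mul] at hc
  simp only [Fin.is_lt, dif_pos, Fin.eta, hc]
  ring

end HasCoords

/-- For `n ≥ 3` and `0 ≤ k ≤ n`, the products `ζ_(n-k+1)ζ_(n-2)`, `ζ_(n-k)ζ_(n-1)`,
`ζ_(n-k)ζ_(n-2)`, `ζ_(n-k-1)ζ_(n-1)` lie in `I_f^(n-3)`, and writing each of them in the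
basis `1, θ, …, θ^(n-3), ζ_(n-2), ζ_(n-1)` of `I_f^(n-3)` with `ζ_(n-2)`-coordinate `c_x`
and `ζ_(n-1)`-coordinate `c_y`, one has
`f_(n-k) = c_y(ζ_(n-k+1)ζ_(n-2)) + c_y(ζ_(n-k)ζ_(n-1)) − c_x(ζ_(n-k)ζ_(n-2)) − c_x(ζ_(n-k-1)ζ_(n-1))`. -/
theorem stmt17 (n : ℕ) (hn : 3 ≤ n) (f : ℕ → ℤ) (hf0 : f 0 ≠ 0)
    (k : ℕ) (hk : k ≤ n) :
    (∀ m : Fin 4, prods n f k m ∈ Ifpow n f (n - 3)) ∧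
    ∃ (c : Fin 4 → ℕ → ℤ) (cx cy : Fin 4 → ℤ),
      (∀ m : Fin 4,
        prods n f k m =
          (∑ t ∈ Finset.range (n - 2), (c m t : Qf n f) * th n f ^ t) +
            (cx m : Qf n f) * zeta n f (n - 2) + (cy m : Qf n f) * zeta n f (n - 1)) ∧
      f (n - k) = cy 0 + cy 1 - cx 2 - cx 3 := by
  have h : ∃ cx cy : Fin 4 → ℤ, (∀ m, HasCoords n f (prods n f k m) (cx m) (cy m)) ∧
      f (n - k) = cy 0 + cy 1 - cx 2 - cx 3 := by
    have h0 := HasCoords.zetaZ_mul_penultimate (f := f) hn ((n : ℤ) - k + 1)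
    have h1 := HasCoords.zetaZ_mul_last (f := f) hn ((n : ℤ) - k)
    have h2 := HasCoords.zetaZ_mul_penultimate (f := f) hn ((n : ℤ) - k)
    have h3 := HasCoords.zetaZ_mul_last (f := f) hn ((n : ℤ) - k - 1)
    have combine {a₀ b₀ a₁ b₁ a₂ b₂ a₃ b₃ : ℤ} (h₀ : HasCoords n f (prods n f k 0) a₀ b₀)
        (h₁ : HasCoords n f (prods n f k 1) a₁ b₁) (h₂ : HasCoords n f (prods n f k 2) a₂ b₂)
        (h₃ : HasCoords n f (prods n f k 3) a₃ b₃) (hf : f (n - k) = b₀ + b₁ - a₂ - a₃) :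
        ∃ cx cy : Fin 4 → ℤ, (∀ m, HasCoords n f (prods n f k m) (cx m) (cy m)) ∧
          f (n - k) = cy 0 + cy 1 - cx 2 - cx 3 :=
      ⟨![a₀, a₁, a₂, a₃], ![b₀, b₁, b₂, b₃], by intro m; fin_cases m <;> assumption, hf⟩
    refine combine h0 h1 h2 h3 ?_
    rw [show ((n : ℤ) - k + 1 - 1).toNat = n - k by omega]
    obtain h | rfl | rfl | rfl : 3 ≤ k ∨ k = 0 ∨ k = 1 ∨ k = 2 := by omega
    all_goals split_ifs <;> first | omega | simp
  obtain ⟨cx, cy, hcoords, hf⟩ := h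
  choose c hc using fun m => (hcoords m).exists_eq hn
  exact ⟨fun m => Rf_le_Ifpow n f _ (hcoords m).1, c, cx, cy, hc, hf⟩

end
end
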